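/- Special mixed product identities: (i) for all A, B ∈ ℝ^{m×n} and C ∈ ℝ^{n×p}, (A ⊗ₛ B)(C ⊗ₛ C) = AC ⊗ₛ BC; (ii) for all A, B ∈ ℝ^{m×n} and C ∈ ℝ^{p×m}, (C ⊗ₛ C)(A ⊗ₛ B) = CA ⊗ₛ CB. -/

import Mathlib

open Matrix

noncomputable section

/-- `n̄ = n(n+1)/2`, the dimension of the space of symmetric `n × n` matrices. -/
def triDim (n : ℕ) : ℕ := n * (n + 1) / 2

/-- The (0-based) row/column pair `(r(j), c(j))` of the `j`-th position in the
lexicographic (left-to-right, top-to-bottom) enumeration of the on-or-above-diagonal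
positions of an `n × n` matrix. -/
def rcPair : ℕ → ℕ → ℕ × ℕ
  | 0, _ => (0, 0)
  | (m + 1), j =>
      if j < m + 1 then (0, j)
      else ((rcPair m (j - (m + 1))).1 + 1, (rcPair m (j - (m + 1))).2 + 1)

/-- The orthonormal basis `E_j` of the space of symmetric `n × n` matrices:
`E_j = e_{r(j)} e_{c(j)}ᵀ` if `r(j) = c(j)`, and
`E_j = (√2/2) (e_{r(j)} e_{c(j)}ᵀ + e_{c(j)} e_{r(j)}ᵀ)` if `r(j) < c(j)`. -/
def symBasis (n : ℕ) (j : Fin (triDim n)) : Matrix (Fin n) (Fin n) ℝ :=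
  if (rcPair n j).1 = (rcPair n j).2 then
    Matrix.of fun a b : Fin n =>
      if (a : ℕ) = (rcPair n j).1 ∧ (b : ℕ) = (rcPair n j).2 then (1 : ℝ) else 0
  else
    Matrix.of fun a b : Fin n =>
      if ((a : ℕ) = (rcPair n j).1 ∧ (b : ℕ) = (rcPair n j).2) ∨
          ((a : ℕ) = (rcPair n j).2 ∧ (b : ℕ) = (rcPair n j).1) then
        Real.sqrt 2 / 2
      else 0

/-- Column-stacking vectorization `vec : ℝ^{m×n} → ℝ^{nm}`: `vec(A)_{j·m + i} = A_{i,j}`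
(0-based), realized through `finProdFinEquiv (j, i) = j * m + i`. -/
def mvec {m n : ℕ} (A : Matrix (Fin m) (Fin n) ℝ) : Fin (n * m) → ℝ :=
  fun k => A (finProdFinEquiv.symm k).2 (finProdFinEquiv.symm k).1

/-- The matrix `W_n ∈ ℝ^{n̄ × n²}` whose `j`-th row is `vec(E_j)ᵀ`. -/
def Wmat (n : ℕ) : Matrix (Fin (triDim n)) (Fin (n * n)) ℝ :=
  Matrix.of fun j k => mvec (symBasis n j) k

/-- The Kronecker product on `Fin`-indexed matrices, with the standard flattening
`(A ⊗ B)_{(i·p + k, j·q + l)} = A_{i,j} B_{k,l}`. -/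
def kron {m n p q : ℕ} (A : Matrix (Fin m) (Fin n) ℝ) (B : Matrix (Fin p) (Fin q) ℝ) :
    Matrix (Fin (m * p)) (Fin (n * q)) ℝ :=
  Matrix.reindex finProdFinEquiv finProdFinEquiv (Matrix.kroneckerMap (· * ·) A B)

/-- The symmetric Kronecker product `A ⊗ₛ B = W_m (A ⊗ B) W_nᵀ ∈ ℝ^{m̄ × n̄}`
of rectangular matrices `A, B ∈ ℝ^{m×n}`. -/
def skron {m n : ℕ} (A B : Matrix (Fin m) (Fin n) ℝ) :
    Matrix (Fin (triDim m)) (Fin (triDim n)) ℝ :=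
  Wmat m * kron A B * (Wmat n)ᵀ

/-- The Frobenius inner product `⟨A, B⟩_F = trace(Aᵀ B)`. -/
def frobInner {m n : ℕ} (A B : Matrix (Fin m) (Fin n) ℝ) : ℝ :=
  (Aᵀ * B).trace

/-- Symmetric vectorization `svec(P)_j = ⟨P, E_j⟩_F`. -/
def svec {n : ℕ} (P : Matrix (Fin n) (Fin n) ℝ) : Fin (triDim n) → ℝ :=
  fun j => frobInner P (symBasis n j)

/-- The symmetric part `π(A) = (A + Aᵀ)/2`. -/
def symPart {n : ℕ} (A : Matrix (Fin n) (Fin n) ℝ) : Matrix (Fin n) (Fin n) ℝ :=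
  (1 / 2 : ℝ) • (A + Aᵀ)

/-- The symmetric Kronecker sum `A ⊕ₛ B = A ⊗ₛ I + I ⊗ₛ B`. -/
def skronSum {n : ℕ} (A B : Matrix (Fin n) (Fin n) ℝ) :
    Matrix (Fin (triDim n)) (Fin (triDim n)) ℝ :=
  skron A 1 + skron 1 B

/-- A vector `x ∈ ℝⁿ` regarded as an `n × 1` matrix. -/
def colVec {n : ℕ} (x : Fin n → ℝ) : Matrix (Fin n) (Fin 1) ℝ :=
  Matrix.of fun i _ => x i

theorem triDim_succ (n : ℕ) : triDim (n + 1) = triDim n + (n + 1) := by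
  unfold triDim
  rw [show (n + 1) * (n + 1 + 1) = n * (n + 1) + (n + 1) * 2 by ring,
    Nat.add_mul_div_right _ _ two_pos]

theorem rcPair_fst_le_snd (n j : ℕ) : (rcPair n j).1 ≤ (rcPair n j).2 := by
  induction n generalizing j with
  | zero => simp [rcPair]
  | succ n ih =>
    unfold rcPair
    split_ifs
    · exact Nat.zero_le _
    · exact Nat.succ_le_succ (ih _)

theorem exists_rcPair_eq (n : ℕ) {r c : ℕ} (hrc : r ≤ c) (hc : c < n) :
    ∃ j < triDim n, rcPair n j = (r, c) := by
  induction n generalizing r c with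
  | zero => omega
  | succ n ih =>
    rw [triDim_succ]
    cases r with
    | zero => exact ⟨c, by omega, by simp [rcPair, hc]⟩
    | succ r =>
      obtain ⟨c, rfl⟩ : ∃ d, c = d + 1 := ⟨c - 1, by omega⟩
      obtain ⟨j, hj, h⟩ := ih (r := r) (c := c) (by omega) (by omega)
      exact ⟨j + (n + 1), by omega, by simp [rcPair, h]; omega⟩

theorem rcPair_injOn (n : ℕ) {i j : ℕ} (hi : i < triDim n) (hj : j < triDim n)
    (h : rcPair n i = rcPair n j) : i = j := by
  induction n generalizing i j with
  | zero => simp [triDim] at hi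
  | succ n ih =>
    rw [triDim_succ] at hi hj
    unfold rcPair at h
    split_ifs at h with h₁ h₂ h₂
    · simpa using h
    · simp at h
    · simp at h
    · simp only [Prod.mk.injEq, add_left_inj] at h
      have := ih (i := i - (n + 1)) (j := j - (n + 1)) (by omega) (by omega)
        (Prod.ext h.1 h.2)
      omega

theorem symBasis_apply (n : ℕ) (j : Fin (triDim n)) (a b : Fin n) :
    symBasis n j a b =
      if rcPair n j = (min (a : ℕ) b, max (a : ℕ) b) then
        (if a = b then 1 else Real.sqrt 2 / 2) else 0 := by
  have hle := rcPair_fst_le_snd n j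
  unfold symBasis
  generalize rcPair n j = q at *
  obtain ⟨r, c⟩ := q
  simp only [Prod.mk.injEq, Fin.ext_iff] at *
  by_cases hrc : r = c
  · rw [if_pos hrc, Matrix.of_apply]
    split_ifs <;> first | rfl | omega
  · rw [if_neg hrc, Matrix.of_apply]
    split_ifs <;> first | rfl | omega

theorem symBasis_comm (n : ℕ) (j : Fin (triDim n)) (a b : Fin n) :
    symBasis n j a b = symBasis n j b a := by
  simp only [symBasis_apply, min_comm, max_comm, eq_comm]

theorem sum_symBasis_mul_symBasis (n : ℕ) (a b c d : Fin n) :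
    ∑ j, symBasis n j a b * symBasis n j c d =
      (1 / 2 : ℝ) * ((if a = c ∧ b = d then 1 else 0) + if a = d ∧ b = c then 1 else 0) := by
  obtain ⟨k, hk, hkab⟩ := exists_rcPair_eq n (r := min (a : ℕ) b) (c := max (a : ℕ) b)
    (by omega) (by omega)
  have hsqrt : Real.sqrt 2 / 2 * (Real.sqrt 2 / 2) = 1 / 2 := by
    have := Real.mul_self_sqrt (zero_le_two (α := ℝ))
    linarith
  rw [Finset.sum_eq_single (⟨k, hk⟩ : Fin (triDim n))]
  · simp only [symBasis_apply, hkab, Prod.mk.injEq, Fin.ext_iff]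
    split_ifs <;> first | omega | norm_num [hsqrt]
  · intro j _ hj
    rw [symBasis_apply n j a b, if_neg, zero_mul]
    intro h
    exact hj (Fin.ext (rcPair_injOn n j.2 hk (h.trans hkab.symm)))
  · simp

/-- The permutation of the coordinates of `vec A` that transposes `A`. -/
def vecTranspose (n : ℕ) : Fin (n * n) ≃ Fin (n * n) :=
  finProdFinEquiv.symm.trans ((Equiv.prodComm _ _).trans finProdFinEquiv)

theorem Wmat_submatrix_vecTranspose (n : ℕ) :
    (Wmat n).submatrix id (vecTranspose n) = Wmat n := by
  ext j k
  obtain ⟨⟨a, b⟩, rfl⟩ := finProdFinEquiv.surjective k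
  simp only [Wmat, mvec, vecTranspose, Matrix.submatrix_apply, Matrix.of_apply, id_eq,
    Equiv.trans_apply, Equiv.symm_apply_apply, Equiv.prodComm_apply, Prod.swap_prod_mk,
    symBasis_comm n j a b]

theorem kron_self_submatrix_vecTranspose {m n : ℕ} (C : Matrix (Fin m) (Fin n) ℝ) :
    (kron C C).submatrix (vecTranspose m) (vecTranspose n) = kron C C := by
  ext k l
  simp [kron, vecTranspose, mul_comm]

theorem Wmat_transpose_mul_self (n : ℕ) :
    (Wmat n)ᵀ * Wmat n =
      (1 / 2 : ℝ) • (1 + (1 : Matrix (Fin (n * n)) (Fin (n * n)) ℝ).submatrix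
        (vecTranspose n) id) := by
  ext k l
  obtain ⟨⟨a, b⟩, rfl⟩ := finProdFinEquiv.surjective k
  obtain ⟨⟨c, d⟩, rfl⟩ := finProdFinEquiv.surjective l
  have h := sum_symBasis_mul_symBasis n b a d c
  simp only [Matrix.mul_apply, Wmat, mvec, vecTranspose, Matrix.transpose_apply,
    Matrix.of_apply, Equiv.symm_apply_apply, h, Matrix.smul_apply, Matrix.add_apply,
    Matrix.submatrix_apply, Matrix.one_apply, Equiv.trans_apply, Equiv.prodComm_apply,
    Prod.swap_prod_mk, id_eq, EmbeddingLike.apply_eq_iff_eq, Prod.mk.injEq, smul_eq_mul,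
    and_comm]

theorem one_submatrix_vecTranspose_mul {n p : ℕ} (M : Matrix (Fin (n * n)) (Fin p) ℝ) :
    (1 : Matrix (Fin (n * n)) (Fin (n * n)) ℝ).submatrix (vecTranspose n) id * M =
      M.submatrix (vecTranspose n) id :=
  Matrix.one_submatrix_mul (vecTranspose n) (Equiv.refl _) M

theorem Wmat_mul_projection (n : ℕ) : Wmat n * ((Wmat n)ᵀ * Wmat n) = Wmat n := by
  have h : Wmat n * (1 : Matrix (Fin (n * n)) (Fin (n * n)) ℝ).submatrix (vecTranspose n) id =
      Wmat n := by
    conv_lhs => rw [← Wmat_submatrix_vecTranspose n]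
    rw [Matrix.submatrix_mul_equiv, Matrix.mul_one, Matrix.submatrix_id_id]
  rw [Wmat_transpose_mul_self, Matrix.mul_smul, Matrix.mul_add, Matrix.mul_one, h, ← two_smul ℝ,
    smul_smul]
  norm_num

theorem projection_mul_kron_self {m n : ℕ} (C : Matrix (Fin m) (Fin n) ℝ) :
    (Wmat m)ᵀ * Wmat m * kron C C = kron C C * ((Wmat n)ᵀ * Wmat n) := by
  have h : kron C C * (1 : Matrix (Fin (n * n)) (Fin (n * n)) ℝ).submatrix (vecTranspose n) id =
      (kron C C).submatrix (vecTranspose m) id := by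
    conv_lhs => rw [← kron_self_submatrix_vecTranspose C]
    rw [Matrix.submatrix_mul_equiv, Matrix.mul_one]
  rw [Wmat_transpose_mul_self, Wmat_transpose_mul_self, Matrix.mul_smul, Matrix.mul_add,
    Matrix.mul_one, h, Matrix.smul_mul, Matrix.add_mul, Matrix.one_mul,
    one_submatrix_vecTranspose_mul]

theorem kron_mul_kron {m n p q r s : ℕ} (A : Matrix (Fin m) (Fin n) ℝ)
    (B : Matrix (Fin p) (Fin q) ℝ) (C : Matrix (Fin n) (Fin r) ℝ)
    (D : Matrix (Fin q) (Fin s) ℝ) : kron A B * kron C D = kron (A * C) (B * D) := by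
  simp only [kron, Matrix.reindex_apply, Matrix.submatrix_mul_equiv]
  exact congrArg (fun M => M.submatrix finProdFinEquiv.symm finProdFinEquiv.symm)
    (Matrix.mul_kronecker_mul A C B D).symm

theorem projection_mul_Wmat_transpose (n : ℕ) :
    (Wmat n)ᵀ * Wmat n * (Wmat n)ᵀ = (Wmat n)ᵀ := by
  have h := congrArg Matrix.transpose (Wmat_mul_projection n)
  simpa [Matrix.transpose_mul] using h

/-- special mixed product identities:
(i) `(A ⊗ₛ B)(C ⊗ₛ C) = AC ⊗ₛ BC`; (ii) `(C ⊗ₛ C)(A ⊗ₛ B) = CA ⊗ₛ CB`. -/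
theorem skron_mixed_prod_special (m n : ℕ) :
    (∀ (p : ℕ) (A B : Matrix (Fin m) (Fin n) ℝ) (C : Matrix (Fin n) (Fin p) ℝ),
      skron A B * skron C C = skron (A * C) (B * C)) ∧
    (∀ (p : ℕ) (A B : Matrix (Fin m) (Fin n) ℝ) (C : Matrix (Fin p) (Fin m) ℝ),
      skron C C * skron A B = skron (C * A) (C * B)) := by
  refine ⟨fun p A B C => ?_, fun p A B C => ?_⟩
  · calc skron A B * skron C C
        = Wmat m * kron A B * ((Wmat n)ᵀ * Wmat n * kron C C) * (Wmat p)ᵀ := by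
          simp only [skron, Matrix.mul_assoc]
      _ = Wmat m * (kron A B * kron C C) * ((Wmat p)ᵀ * Wmat p * (Wmat p)ᵀ) := by
          rw [projection_mul_kron_self]
          simp only [Matrix.mul_assoc]
      _ = skron (A * C) (B * C) := by
          rw [projection_mul_Wmat_transpose, kron_mul_kron, skron]
  · calc skron C C * skron A B
        = Wmat p * (kron C C * ((Wmat m)ᵀ * Wmat m)) * kron A B * (Wmat n)ᵀ := by
          simp only [skron, Matrix.mul_assoc]
      _ = Wmat p * ((Wmat p)ᵀ * Wmat p) * (kron C C * kron A B) * (Wmat n)ᵀ := by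
          rw [← projection_mul_kron_self]
          simp only [Matrix.mul_assoc]
      _ = skron (C * A) (C * B) := by
          rw [Wmat_mul_projection, kron_mul_kron, skron]
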